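/- arXiv:1307.5474 — 2 statements merged into one kernel-verified Lean document; each statement's English description precedes it below -/
import Mathlib

section
/- Let (X,d) be a complete metric space, let {S_i}_{i∈I} be a finite collection of contracting self-maps of X, let C ⊆ X be a nonempty compact set, let F_∅ be the (homogeneous) attractor of {S_i}_{i∈I}, let F_C be the inhomogeneous attractor with condensation set C, and let O = C ∪ ⋃_{i ∈ I*} S_i(C) be the orbital set, where I* = ⋃_{k≥1} I^k and S_{(i_1,…,i_k)} = S_{i_1} ∘ ⋯ ∘ S_{i_k}. Then F_C = F_∅ ∪ O and F_C equals the closure of O. -/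
open Set

/-- For a finite word `l = [i₁, …, i_k]`, the composition `S_{i₁} ∘ ⋯ ∘ S_{i_k}`. -/
def compWord {X : Type*} {I : Type*} (S : I → X → X) : List I → X → X
  | [] => id
  | i :: l => S i ∘ compWord S l

/-- Finitely many contractions admit a common nonnegative contraction ratio. -/
theorem exists_uniform_contraction_ratio {X I : Type*} [MetricSpace X] [Finite I]
    (S : I → X → X)
    (hS : ∀ i, ∃ r : ℝ, r < 1 ∧ ∀ x y, dist (S i x) (S i y) ≤ r * dist x y) :
    ∃ r : ℝ, 0 ≤ r ∧ r < 1 ∧ ∀ i x y, dist (S i x) (S i y) ≤ r * dist x y := by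
  choose ρ hρ hdist using hS
  cases isEmpty_or_nonempty I with
  | inl h => exact ⟨0, le_rfl, one_pos, fun i => (h.false i).elim⟩
  | inr h =>
    obtain ⟨j, hj⟩ := Finite.exists_max ρ
    refine ⟨max 0 (ρ j), le_max_left _ _, max_lt one_pos (hρ j), fun i x y => ?_⟩
    exact (hdist i x y).trans
      (mul_le_mul_of_nonneg_right ((hj i).trans (le_max_right _ _)) dist_nonneg)

/-- A bounded set `A` covered by its images under uniform contractions and a closed nonempty
forward invariant set `B` is contained in `B`. -/
theorem subset_of_subset_iUnion_image_union {X I : Type*} [MetricSpace X] {S : I → X → X}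
    {r : ℝ} (hr0 : 0 ≤ r) (hr1 : r < 1)
    (hS : ∀ i x y, dist (S i x) (S i y) ≤ r * dist x y) {A B : Set X}
    (hA : Bornology.IsBounded A) (hAS : A ⊆ (⋃ i, S i '' A) ∪ B)
    (hBc : IsClosed B) (hBne : B.Nonempty) (hBS : ∀ i, MapsTo (S i) B B) : A ⊆ B := by
  obtain ⟨b, hb⟩ := hBne
  obtain ⟨M, hM⟩ := hA.subset_closedBall b
  have key : ∀ n : ℕ, ∀ x ∈ A, ∃ y ∈ B, dist x y ≤ r ^ n * |M| := by
    intro n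
    induction n with
    | zero =>
      intro x hx
      exact ⟨b, hb, by simpa using (Metric.mem_closedBall.1 (hM hx)).trans (le_abs_self M)⟩
    | succ n ih =>
      intro x hx
      rcases hAS hx with h | h
      · obtain ⟨i, x', hx', rfl⟩ := mem_iUnion.1 h
        obtain ⟨y, hy, hxy⟩ := ih x' hx'
        refine ⟨S i y, hBS i hy, (hS i x' y).trans ?_⟩
        rw [pow_succ', mul_assoc]
        exact mul_le_mul_of_nonneg_left hxy hr0
      · exact ⟨x, h, by rw [dist_self]; positivity⟩
  intro x hx
  rw [← hBc.closure_eq, Metric.mem_closure_iff]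
  intro ε hε
  have hlim : Filter.Tendsto (fun n : ℕ => r ^ n * |M|) Filter.atTop (nhds 0) := by
    simpa using (tendsto_pow_atTop_nhds_zero_of_lt_one hr0 hr1).mul_const |M|
  obtain ⟨n, hn⟩ := (hlim.eventually_lt_const hε).exists
  obtain ⟨y, hy, hxy⟩ := key n x hx
  exact ⟨y, hy, hxy.trans_lt hn⟩

/-- The orbital set is the union of the images of `C` under all words, including the empty one. -/
theorem union_iUnion_compWord_image {X I : Type*} (S : I → X → X) (C : Set X) :
    C ∪ ⋃ (l : List I) (_ : l ≠ []), compWord S l '' C = ⋃ l : List I, compWord S l '' C := by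
  refine Subset.antisymm (union_subset ?_ ?_) (iUnion_subset fun l => ?_)
  · intro x hx
    exact mem_iUnion.2 ⟨[], x, hx, rfl⟩
  · exact iUnion_mono fun l => iUnion_subset fun _ => Subset.rfl
  · by_cases hl : l = []
    · subst hl
      rintro _ ⟨x, hx, rfl⟩
      exact Or.inl hx
    · exact fun x hx => Or.inr (mem_iUnion₂.2 ⟨l, hl, hx⟩)

theorem mapsTo_iUnion_compWord_image {X I : Type*} (S : I → X → X) (C : Set X) (i : I) :
    MapsTo (S i) (⋃ l : List I, compWord S l '' C) (⋃ l : List I, compWord S l '' C) := by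
  intro x hx
  obtain ⟨l, c, hc, rfl⟩ := mem_iUnion.1 hx
  exact mem_iUnion.2 ⟨i :: l, c, hc, rfl⟩

theorem mapsTo_compWord {X I : Type*} {S : I → X → X} {B : Set X}
    (hB : ∀ i, MapsTo (S i) B B) (l : List I) : MapsTo (compWord S l) B B := by
  induction l with
  | nil => exact mapsTo_id B
  | cons i l ih => exact (hB i).comp ih

/-- **Structure of inhomogeneous attractors.**
Let `X` be a complete metric space, `{S i}` a finite collection of contracting self-maps, `C` a
nonempty compact condensation set, `F0` the homogeneous attractor, `FC` the inhomogeneous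
attractor, and `O = C ∪ ⋃_{𝐢 ∈ I*} S_𝐢(C)` the orbital set (`I*` the nonempty finite words).
Then `FC = F0 ∪ O` and `FC = closure O`. -/
theorem inhomogeneous_attractor_eq_union_orbital_eq_closure
    {X : Type*} [MetricSpace X] [CompleteSpace X]
    {I : Type*} [Finite I] (S : I → X → X)
    (hS : ∀ i, ∃ r : ℝ, r < 1 ∧ ∀ x y, dist (S i x) (S i y) ≤ r * dist x y)
    (C : Set X) (hCc : IsCompact C) (hCne : C.Nonempty)
    (F0 : Set X) (hF0ne : F0.Nonempty) (hF0c : IsCompact F0)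
    (hF0eq : F0 = ⋃ i, S i '' F0)
    (FC : Set X) (hFCne : FC.Nonempty) (hFCc : IsCompact FC)
    (hFCeq : FC = (⋃ i, S i '' FC) ∪ C)
    (O : Set X) (hO : O = C ∪ ⋃ (l : List I) (_ : l ≠ []), compWord S l '' C) :
    FC = F0 ∪ O ∧ FC = closure O := by
  rw [union_iUnion_compWord_image] at hO
  obtain ⟨r, hr0, hr1, hr⟩ := exists_uniform_contraction_ratio S hS
  have hcont : ∀ i, Continuous (S i) := fun i =>
    (LipschitzWith.of_dist_le_mul (K := ⟨r, hr0⟩) (hr i)).continuous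
  have hF0S : ∀ i, MapsTo (S i) F0 F0 := fun i x hx => by
    rw [hF0eq]
    exact mem_iUnion.2 ⟨i, x, hx, rfl⟩
  have hFCS : ∀ i, MapsTo (S i) FC FC := fun i x hx => by
    rw [hFCeq]
    exact Or.inl (mem_iUnion.2 ⟨i, x, hx, rfl⟩)
  have hOS : ∀ i, MapsTo (S i) O O := by
    rw [hO]
    exact mapsTo_iUnion_compWord_image S C
  have hCO : C ⊆ O := by
    rw [hO]
    exact fun x hx => mem_iUnion.2 ⟨[], x, hx, rfl⟩
  have hCFC : C ⊆ FC := by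
    rw [hFCeq]
    exact subset_union_right
  have hOFC : O ⊆ FC := by
    rw [hO]
    exact iUnion_subset fun l => ((mapsTo_compWord hFCS l).mono_left hCFC).image_subset
  have hF0FC : F0 ⊆ FC :=
    subset_of_subset_iUnion_image_union hr0 hr1 hr hF0c.isBounded
      (hF0eq.subset.trans subset_union_left) hFCc.isClosed hFCne hFCS
  have hdiff : FC \ O ⊆ F0 := by
    refine subset_of_subset_iUnion_image_union hr0 hr1 hr (hFCc.isBounded.subset sdiff_subset)
      ?_ hF0c.isClosed hF0ne hF0S
    rintro x ⟨hx, hxO⟩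
    rcases hFCeq.subset hx with h | h
    · obtain ⟨i, y, hy, rfl⟩ := mem_iUnion.1 h
      exact Or.inl (mem_iUnion.2 ⟨i, y, ⟨hy, fun hyO => hxO (hOS i hyO)⟩, rfl⟩)
    · exact absurd (hCO h) hxO
  refine ⟨Subset.antisymm (fun x hx => ?_) (union_subset hF0FC hOFC),
    Subset.antisymm ?_ (closure_minimal hOFC hFCc.isClosed)⟩
  · by_cases hxO : x ∈ O
    · exact Or.inr hxO
    · exact Or.inl (hdiff ⟨hx, hxO⟩)
  · exact subset_of_subset_iUnion_image_union hr0 hr1 hr hFCc.isBounded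
      (hFCeq.subset.trans (union_subset_union_right _ (hCO.trans subset_closure)))
      isClosed_closure (hCne.mono (hCO.trans subset_closure))
      fun i => (hOS i).closure (hcont i)
end

section
/- Let {S_i}_{i∈I} be a finite collection of contracting self-maps of a complete metric space X, let C ⊆ X be a nonempty compact set, let F_∅ be the homogeneous attractor and F_C the inhomogeneous attractor with condensation set C. Then the Hausdorff dimension satisfies dim_H F_C = max{dim_H F_∅, dim_H C}. -/
open Set

/-- A finite family of contractions admits a common positive contraction ratio below `1`. -/
theorem exists_common_contraction_ratio {X : Type*} [PseudoMetricSpace X] {I : Type*} [Finite I]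
    {S : I → X → X}
    (hS : ∀ i, ∃ r : ℝ, r < 1 ∧ ∀ x y, dist (S i x) (S i y) ≤ r * dist x y) :
    ∃ r : ℝ, 0 < r ∧ r < 1 ∧ ∀ i x y, dist (S i x) (S i y) ≤ r * dist x y := by
  choose ρ hρ hd using hS
  have hev : ∀ᶠ r in nhdsWithin (1 : ℝ) (Iio 1), 0 < r ∧ r < 1 ∧ ∀ i, ρ i < r := by
    refine ((lt_mem_nhds one_pos).filter_mono nhdsWithin_le_nhds).and
      (Filter.Eventually.and self_mem_nhdsWithin (Filter.eventually_all.2 fun i => ?_))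
    exact (lt_mem_nhds (hρ i)).filter_mono nhdsWithin_le_nhds
  obtain ⟨r, h0, h1, hr⟩ := hev.exists
  exact ⟨r, h0, h1, fun i x y =>
    (hd i x y).trans (mul_le_mul_of_nonneg_right (hr i).le dist_nonneg)⟩

/-- A bounded set covered by its own images under uniform contractions lies in every nonempty
closed set that is forward invariant under these contractions. -/
theorem subset_of_subset_iUnion_image {X : Type*} [PseudoMetricSpace X] {I : Type*}
    {S : I → X → X} {r : ℝ} (hr0 : 0 < r) (hr1 : r < 1)
    (hS : ∀ i x y, dist (S i x) (S i y) ≤ r * dist x y) {A B : Set X}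
    (hA : Bornology.IsBounded A) (hAS : A ⊆ ⋃ i, S i '' A) (hB : IsClosed B) (hBne : B.Nonempty)
    (hBS : ∀ i, MapsTo (S i) B B) : A ⊆ B := by
  have hstep : ∀ i y, Metric.infDist (S i y) B ≤ r * Metric.infDist y B := by
    intro i y
    rw [← div_le_iff₀' hr0]
    refine (Metric.le_infDist hBne).2 fun {b} hb => ?_
    rw [div_le_iff₀' hr0]
    exact (Metric.infDist_le_dist_of_mem (hBS i hb)).trans (hS i y b)
  have hbdd : BddAbove ((fun x => Metric.infDist x B) '' A) :=
    ((Metric.lipschitz_infDist_pt B).isBounded_image hA).bddAbove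
  intro x hx
  have hle : ∀ y ∈ A, Metric.infDist y B ≤ sSup ((fun x => Metric.infDist x B) '' A) :=
    fun y hy => le_csSup hbdd (mem_image_of_mem _ hy)
  have hsup : sSup ((fun x => Metric.infDist x B) '' A) ≤
      r * sSup ((fun x => Metric.infDist x B) '' A) := by
    refine csSup_le ⟨_, mem_image_of_mem _ hx⟩ ?_
    rintro _ ⟨z, hz, rfl⟩
    obtain ⟨i, y, hy, rfl⟩ := mem_iUnion.1 (hAS hz)
    exact (hstep i y).trans (mul_le_mul_of_nonneg_left (hle y hy) hr0.le)
  rw [hB.mem_iff_infDist_zero hBne]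
  refine le_antisymm ?_ Metric.infDist_nonneg
  have := hle x hx
  nlinarith

/-- Iterating a countable family of Lipschitz maps does not increase the Hausdorff dimension. -/
theorem dimH_iterate_iUnion_image_le {X : Type*} [MetricSpace X] {I : Type*} [Countable I]
    {S : I → X → X} {K : NNReal} (hS : ∀ i, LipschitzWith K (S i)) (C : Set X) (n : ℕ) :
    dimH ((fun s => ⋃ i, S i '' s)^[n] C) ≤ dimH C := by
  induction n with
  | zero => rfl
  | succ n ih =>
    rw [Function.iterate_succ_apply', dimH_iUnion]
    exact iSup_le fun i => ((hS i).dimH_image_le _).trans ih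

/-- **Hausdorff dimension of inhomogeneous attractors.**
Let `X` be a complete metric space, `{S i}` a finite collection of contracting self-maps, `C` a
nonempty compact condensation set, `F0` the homogeneous attractor and `FC` the inhomogeneous
attractor.  Then `dimH FC = max (dimH F0) (dimH C)`. -/
theorem dimH_inhomogeneous_attractor
    {X : Type*} [MetricSpace X] [CompleteSpace X]
    {I : Type*} [Finite I] (S : I → X → X)
    (hS : ∀ i, ∃ r : ℝ, r < 1 ∧ ∀ x y, dist (S i x) (S i y) ≤ r * dist x y)
    (C : Set X) (hCc : IsCompact C) (hCne : C.Nonempty)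
    (F0 : Set X) (hF0ne : F0.Nonempty) (hF0c : IsCompact F0)
    (hF0eq : F0 = ⋃ i, S i '' F0)
    (FC : Set X) (hFCne : FC.Nonempty) (hFCc : IsCompact FC)
    (hFCeq : FC = (⋃ i, S i '' FC) ∪ C) :
    dimH FC = max (dimH F0) (dimH C) := by
  obtain ⟨r, hr0, hr1, hr⟩ := exists_common_contraction_ratio hS
  have hLip : ∀ i, LipschitzWith ⟨r, hr0.le⟩ (S i) :=
    fun i => LipschitzWith.of_dist_le_mul (hr i)
  have hmaps : ∀ i, MapsTo (S i) FC FC := fun i x hx => by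
    rw [hFCeq]
    exact Or.inl (mem_iUnion.2 ⟨i, mem_image_of_mem _ hx⟩)
  have hmaps0 : ∀ i, MapsTo (S i) F0 F0 := fun i x hx => by
    rw [hF0eq]
    exact mem_iUnion.2 ⟨i, mem_image_of_mem _ hx⟩
  have hCFC : C ⊆ FC := hFCeq ▸ subset_union_right
  have hF0FC : F0 ⊆ FC := subset_of_subset_iUnion_image hr0 hr1 hr hF0c.isBounded hF0eq.subset
    hFCc.isClosed hFCne hmaps
  refine le_antisymm ?_ (max_le (dimH_mono hF0FC) (dimH_mono hCFC))
  set O : Set X := ⋃ n : ℕ, (fun s => ⋃ i, S i '' s)^[n] C with hO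
  have hdiff : FC \ O ⊆ F0 := by
    refine subset_of_subset_iUnion_image hr0 hr1 hr (hFCc.isBounded.subset sdiff_subset) ?_
      hF0c.isClosed hF0ne hmaps0
    rintro x ⟨hx, hxO⟩
    rw [hFCeq] at hx
    rcases hx with hx | hx
    · obtain ⟨i, y, hy, rfl⟩ := mem_iUnion.1 hx
      refine mem_iUnion.2 ⟨i, y, ⟨hy, fun hyO => hxO ?_⟩, rfl⟩
      obtain ⟨n, hn⟩ := mem_iUnion.1 hyO
      refine mem_iUnion.2 ⟨n + 1, ?_⟩
      rw [Function.iterate_succ_apply']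
      exact mem_iUnion.2 ⟨i, mem_image_of_mem _ hn⟩
    · exact absurd (mem_iUnion.2 ⟨0, hx⟩) hxO
  calc dimH FC ≤ dimH (F0 ∪ O) := by
        rw [union_comm]
        exact dimH_mono (sdiff_subset_iff.1 hdiff)
    _ = max (dimH F0) (dimH O) := dimH_union _ _
    _ ≤ max (dimH F0) (dimH C) := by
      refine max_le_max le_rfl ?_
      rw [hO, dimH_iUnion]
      exact iSup_le (dimH_iterate_iUnion_image_le hLip C)
end
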